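/- Suppose ρ ∈ (0,∞) and c > E[X]. Then there exists a unique point a in the open interval ( inf D_I , E[X] ), where D_I := { x ∈ ℝ : I(x) < ∞ } is the effective domain of I, such that ( I(a) + ρ ) / ( a − c ) = I'(a), i.e. the tangent line from the point (c, 0) to the graph of x ↦ I(x) + ρ touches the graph at x = a. -/

import Mathlib

open MeasureTheory Filter Set

/-- The cumulant-generating function of a random variable that is not almost surely constant has a
strictly increasing derivative. -/
theorem strictMono_deriv_cgf_of_nondegenerate
    {Ω : Type*} [MeasurableSpace Ω] {P : Measure Ω} [IsProbabilityMeasure P]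
    {X : Ω → ℝ} (hX : Measurable X) (hnondeg : ∀ t : ℝ, P {ω | X ω = t} < 1)
    (hmgf : ∀ l : ℝ, Integrable (fun ω => Real.exp (l * X ω)) P) :
    StrictMono (deriv (ProbabilityTheory.cgf X P)) := by
  have hint : ∀ t, t ∈ interior (ProbabilityTheory.integrableExpSet X P) := by
    have h : ProbabilityTheory.integrableExpSet X P = univ := eq_univ_of_forall hmgf
    simp [h]
  refine strictMono_of_deriv_pos fun t => ?_
  have hvar := ProbabilityTheory.variance_tilted_mul (hint t)
  rw [iteratedDeriv_succ, iteratedDeriv_one] at hvar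
  rw [← hvar]
  refine lt_of_le_of_ne (ProbabilityTheory.variance_nonneg _ _) fun h0 => ?_
  have hprob := isProbabilityMeasure_tilted (hmgf t)
  have hL := ProbabilityTheory.memLp_tilted_mul (hint t) 2
  have hev : ProbabilityTheory.evariance X (P.tilted (t * X ·)) = 0 := by
    rw [← MemLp.ofReal_variance_eq (by exact_mod_cast hL), ← h0, ENNReal.ofReal_zero]
  rw [ProbabilityTheory.evariance_eq_zero_iff hX.aemeasurable] at hev
  have hae := (absolutelyContinuous_tilted (hmgf t)).ae_le hev
  refine (hnondeg (∫ ω, X ω ∂(P.tilted (t * X ·)))).ne ?_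
  exact (prob_compl_eq_zero_iff (hX (measurableSet_singleton _))).1 hae

/-- A differentiable function on `ℝ` with monotone derivative lies above its tangent lines. -/
theorem add_deriv_mul_le_of_monotone_deriv {f : ℝ → ℝ} (hf : Differentiable ℝ f)
    (hmono : Monotone (deriv f)) (x y : ℝ) : f x + deriv f x * (y - x) ≤ f y := by
  have hc : ConvexOn ℝ univ f := hmono.convexOn_univ_of_deriv hf
  rcases lt_trichotomy x y with h | rfl | h
  · have := hc.deriv_le_slope (mem_univ x) (mem_univ y) h (hf x)
    rw [slope_def_field, le_div_iff₀ (sub_pos.2 h)] at this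
    linarith
  · simp
  · have := hc.slope_le_deriv (mem_univ y) (mem_univ x) h (hf x)
    rw [slope_def_field, div_le_iff₀ (sub_pos.2 h)] at this
    linarith

/-- The value at `c` of the tangent line to a strictly convex function is strictly increasing in
the point of tangency to the left of `c`. -/
theorem StrictConvexOn.tangent_lt_tangent {S : Set ℝ} {f : ℝ → ℝ} (hf : StrictConvexOn ℝ S f)
    (hd : ∀ x ∈ S, DifferentiableAt ℝ f x) {a b c : ℝ} (ha : a ∈ S) (hb : b ∈ S)
    (hab : a < b) (hbc : b < c) :
    f a + deriv f a * (c - a) < f b + deriv f b * (c - b) := by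
  have h1 := hf.deriv_lt_slope ha hb hab (hd a ha)
  rw [slope_def_field, lt_div_iff₀ (sub_pos.2 hab)] at h1
  have h2 := mul_lt_mul_of_pos_right (hf.strictMonoOn_deriv hd ha hb hab) (sub_pos.2 hbc)
  linarith

/-- For `ρ ∈ (0,∞)` and `c > E[X]`, there is a unique point `a` in the open interval
`(inf D_I, E[X])` (where `D_I = {x | I(x) < ∞}` is the effective domain of the
Fenchel–Legendre transform `I` of the log-mgf `φ`) such that
`(I(a) + ρ)/(a − c) = I'(a)`, i.e. the tangent from `(c, 0)` to the graph of
`x ↦ I(x) + ρ` touches the graph at `x = a`. -/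
theorem tangent_point_exists_unique
    {Ω : Type*} [MeasurableSpace Ω] (P : Measure Ω) [IsProbabilityMeasure P]
    (X : Ω → ℝ) (hXmeas : Measurable X)
    (hnondeg : ∀ t : ℝ, P {ω | X ω = t} < 1)
    (hmgf : ∀ l : ℝ, Integrable (fun ω => Real.exp (l * X ω)) P)
    (φ : ℝ → ℝ) (hφ : φ = fun l => Real.log (∫ ω, Real.exp (l * X ω) ∂P))
    (I : ℝ → EReal) (hI : I = fun x => ⨆ l : ℝ, ((l * x - φ l : ℝ) : EReal))
    (DI : Set ℝ) (hDI : DI = {x | I x < ⊤})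
    (Ir : ℝ → ℝ) (hIr : Ir = fun x => (I x).toReal)
    (hconv : StrictConvexOn ℝ (interior DI) Ir)
    (hdiff : ∀ x ∈ interior DI, DifferentiableAt ℝ Ir x)
    (EX : ℝ) (hEX : EX = ∫ ω, X ω ∂P)
    (hderivEX : deriv Ir EX = 0)
    (hderivBot : Filter.Tendsto (deriv Ir) (Filter.atBot ⊓ Filter.principal (interior DI))
      Filter.atBot)
    (ρ : ℝ) (hρ : 0 < ρ) (c : ℝ) (hc : EX < c) :
    ∃! a : ℝ, (sInf (Real.toEReal '' DI) < (a : EReal) ∧ a < EX) ∧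
      (Ir a + ρ) / (a - c) = deriv Ir a := by
  have hcgf : φ = ProbabilityTheory.cgf X P := hφ
  have huniv : ProbabilityTheory.integrableExpSet X P = univ := eq_univ_of_forall hmgf
  have hmono : StrictMono (deriv φ) :=
    hcgf ▸ strictMono_deriv_cgf_of_nondegenerate hXmeas hnondeg hmgf
  have hφd : Differentiable ℝ φ := fun t => by
    rw [hcgf]
    exact (ProbabilityTheory.analyticAt_cgf (by simp [huniv])).differentiableAt
  have hφ0 : φ 0 = 0 := by rw [hcgf, ProbabilityTheory.cgf_zero]
  have hEX' : deriv φ 0 = EX := by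
    rw [hcgf, ProbabilityTheory.deriv_cgf_zero (by simp [huniv]), hEX]
    simp
  have htan := add_deriv_mul_le_of_monotone_deriv hφd hmono.monotone
  have hle : ∀ x l : ℝ, ((l * x - φ l : ℝ) : EReal) ≤ I x := fun x l => by
    rw [hI]
    exact le_iSup (fun l : ℝ => ((l * x - φ l : ℝ) : EReal)) l
  have hIr_coe : ∀ x ∈ DI, ((Ir x : ℝ) : EReal) = I x := fun x hx => by
    rw [hDI] at hx
    rw [hIr]
    refine EReal.coe_toReal hx.ne fun hbot => ?_
    have := hle x 0
    rw [hbot, le_bot_iff] at this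
    exact EReal.coe_ne_bot _ this
  have hIr_le : ∀ x ∈ DI, ∀ l, l * x - φ l ≤ Ir x := fun x hx l => by
    have := hle x l
    rw [← hIr_coe x hx] at this
    exact_mod_cast this
  have hI_deriv : ∀ l, I (deriv φ l) = ((l * deriv φ l - φ l : ℝ) : EReal) := fun l => by
    refine le_antisymm ?_ (hle _ _)
    rw [hI]
    refine iSup_le fun k => EReal.coe_le_coe_iff.2 ?_
    linarith [htan l k]
  have hmem : ∀ l, deriv φ l ∈ DI := fun l => by
    rw [hDI, mem_ofPred_eq, hI_deriv]
    exact EReal.coe_lt_top _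
  have hIr_deriv : ∀ l, Ir (deriv φ l) = l * deriv φ l - φ l := fun l => by
    rw [hIr]
    simp only [hI_deriv, EReal.toReal_coe]
  have hEXmem : EX ∈ DI := hEX' ▸ hmem 0
  have hinterior : ∀ a : ℝ, sInf (Real.toEReal '' DI) < (a : EReal) → a < EX →
      a ∈ interior DI := fun a ha haE => by
    obtain ⟨_, ⟨d, hd, rfl⟩, hda⟩ := sInf_lt_iff.1 ha
    rw [EReal.coe_lt_coe_iff] at hda
    refine interior_maximal (fun x hx => ?_) isOpen_Ioo (show a ∈ Ioo d EX from ⟨hda, haE⟩)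
    have hbound : I x ≤ ((max (Ir d) (Ir EX) : ℝ) : EReal) := by
      rw [hI]
      refine iSup_le fun l => EReal.coe_le_coe_iff.2 ?_
      rcases le_total 0 l with hl | hl
      · refine le_trans ?_ ((hIr_le EX hEXmem l).trans (le_max_right _ _))
        linarith [mul_le_mul_of_nonneg_left hx.2.le hl]
      · refine le_trans ?_ ((hIr_le d hd l).trans (le_max_left _ _))
        linarith [mul_le_mul_of_nonpos_left hx.1.le hl]
    rw [hDI]
    exact hbound.trans_lt (EReal.coe_lt_top _)
  have htangent : ∀ a, a < EX → ((Ir a + ρ) / (a - c) = deriv Ir a ↔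
      Ir a + deriv Ir a * (c - a) = -ρ) := fun a ha => by
    rw [div_eq_iff (by linarith : a - c ≠ 0)]
    constructor <;> intro h <;> linarith
  obtain ⟨l, hl0, hl⟩ : ∃ l < 0, c * l - φ l = -ρ := by
    have hcE : 0 < c - EX := sub_pos.2 hc
    have hk : -ρ / (c - EX) ≤ 0 := (div_neg_of_neg_of_pos (neg_lt_zero.2 hρ) hcE).le
    have hcont : Continuous fun l => c * l - φ l := by
      have := hφd.continuous
      fun_prop
    have hlow : c * (-ρ / (c - EX)) - φ (-ρ / (c - EX)) ≤ -ρ := by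
      have h1 := htan 0 (-ρ / (c - EX))
      rw [hφ0, hEX'] at h1
      have h2 : -ρ / (c - EX) * (c - EX) = -ρ := div_mul_cancel₀ _ hcE.ne'
      linarith
    obtain ⟨l, hlmem, hl⟩ := intermediate_value_Icc hk hcont.continuousOn
      (show -ρ ∈ Icc _ _ from ⟨hlow, by simp [hφ0, hρ.le]⟩)
    refine ⟨l, lt_of_le_of_ne hlmem.2 fun h0 => ?_, hl⟩
    simp only [h0, hφ0] at hl
    linarith
  have haE : deriv φ l < EX := hEX' ▸ hmono hl0
  have hainf : sInf (Real.toEReal '' DI) < ((deriv φ l : ℝ) : EReal) :=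
    (sInf_le (mem_image_of_mem _ (hmem (l - 1)))).trans_lt
      (EReal.coe_lt_coe_iff.2 (hmono (by linarith)))
  have haint := hinterior _ hainf haE
  have hderiv : deriv Ir (deriv φ l) = l := by
    have hmin : IsLocalMin (fun x => Ir x - l * x) (deriv φ l) := by
      filter_upwards [mem_interior_iff_mem_nhds.1 haint] with x hx
      linarith [hIr_le x hx l, hIr_deriv l]
    have hd := (hdiff _ haint).hasDerivAt.sub ((hasDerivAt_id (deriv φ l)).const_mul l)
    linarith [hmin.hasDerivAt_eq_zero hd]
  refine ⟨deriv φ l, ⟨⟨hainf, haE⟩, ?_⟩, ?_⟩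
  · rw [htangent _ haE, hderiv, hIr_deriv]
    linarith
  · rintro b ⟨⟨hbinf, hbE⟩, hb⟩
    have hbint := hinterior b hbinf hbE
    have ha : Ir (deriv φ l) + deriv Ir (deriv φ l) * (c - deriv φ l) = -ρ := by
      rw [hderiv, hIr_deriv]
      linarith
    rw [htangent b hbE] at hb
    rcases lt_trichotomy b (deriv φ l) with h | h | h
    · linarith [hconv.tangent_lt_tangent hdiff hbint haint h (haE.trans hc)]
    · exact h
    · linarith [hconv.tangent_lt_tangent hdiff haint hbint h (hbE.trans hc)]
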